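/- If (Φ, E₊, E₋) is a generalized almost contact structure on W = V × V* and G is a compatible generalized metric, then G∘Φ = Φ∘G. -/

import Mathlib

open Module

noncomputable section

/-- The generalized tangent space `W = V × V*`. -/
abbrev GT (V : Type*) [AddCommGroup V] [Module ℝ V] := V × (V →ₗ[ℝ] ℝ)

/-- The canonical symmetric pairing `⟨(X,α),(Y,β)⟩ = (β X + α Y)/2` on `W = V × V*`. -/
def gpair {V : Type*} [AddCommGroup V] [Module ℝ V] (u v : GT V) : ℝ :=
  (v.2 u.1 + u.2 v.1) / 2

section Pairing

variable {V : Type*} [AddCommGroup V] [Module ℝ V]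

theorem gpair_comm (u v : GT V) : gpair u v = gpair v u := by
  simp only [gpair, add_comm]

theorem gpair_smul_left (c : ℝ) (u v : GT V) : gpair (c • u) v = c * gpair u v := by
  simp only [gpair, Prod.smul_fst, Prod.smul_snd, map_smul, LinearMap.smul_apply, smul_eq_mul]
  ring

theorem gpair_zero_left (v : GT V) : gpair 0 v = 0 := by
  simp [gpair]

theorem gpair_apply_self_of_skew {Φ : GT V → GT V}
    (hskew : ∀ u v : GT V, gpair (Φ u) v = -gpair u (Φ v)) (u : GT V) :
    gpair u (Φ u) = 0 := by
  have h := hskew u u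
  rw [gpair_comm (Φ u) u] at h
  linarith

/-- The isotropic vectors of a generalized almost contact structure lie in the kernel of `Φ`. -/
theorem apply_eq_zero_of_skew_of_sq {Φ : GT V →ₗ[ℝ] GT V} {E F : GT V}
    (hskew : ∀ u v : GT V, gpair (Φ u) v = -gpair u (Φ v))
    (hsq : ∀ w : GT V, Φ (Φ w) = -w + (2 * gpair F w) • E + (2 * gpair E w) • F)
    (hE : gpair E E = 0) (hEF : 2 * gpair E F = 1) : Φ E = 0 := by
  have hΦΦ : Φ (Φ E) = 0 := by
    rw [hsq, hE, gpair_comm F E, hEF]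
    simp
  have hmul : Φ E = (2 * gpair F (Φ E)) • E := by
    have h := hsq (Φ E)
    rw [hΦΦ, map_zero, gpair_apply_self_of_skew hskew, mul_zero, zero_smul, add_zero] at h
    exact (neg_add_eq_zero.mp h.symm)
  generalize 2 * gpair F (Φ E) = a at hmul
  rw [hmul, map_smul, hmul, smul_smul] at hΦΦ
  have ha : a * a = 0 := by
    have h := gpair_smul_left (a * a) E F
    rw [hΦΦ, gpair_zero_left] at h
    linear_combination (-2) * h - a * a * hEF
  rw [hmul, mul_self_eq_zero.mp ha, zero_smul]

end Pairing

/-- For a generalized almost contact metric structure `(Φ, E₊, E₋, G)` on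
`W = V × V*`, the metric and `Φ` commute: `G ∘ Φ = Φ ∘ G`. -/
theorem stmt5 {V : Type*} [AddCommGroup V] [Module ℝ V] [FiniteDimensional ℝ V]
    (Φ : GT V →ₗ[ℝ] GT V) (Ep Em : GT V) (G : GT V →ₗ[ℝ] GT V)
    (hskew : ∀ u v : GT V, gpair (Φ u) v = - gpair u (Φ v))
    (hsq : ∀ w : GT V, Φ (Φ w) = -w + (2 * gpair Em w) • Ep + (2 * gpair Ep w) • Em)
    (hpp : gpair Ep Ep = 0) (hmm : gpair Em Em = 0)
    (hpm : 2 * gpair Ep Em = 1)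
    (hGsa : ∀ u v : GT V, gpair (G u) v = gpair u (G v))
    (hGsq : ∀ w : GT V, G (G w) = w)
    (hGc : ∀ w : GT V,
      -(Φ (G (Φ w))) = G w - (2 * gpair Ep w) • Ep - (2 * gpair Em w) • Em) :
    ∀ w : GT V, G (Φ w) = Φ (G w) := by
  have hmp : 2 * gpair Em Ep = 1 := by rw [gpair_comm, hpm]
  have hΦp : Φ Ep = 0 := apply_eq_zero_of_skew_of_sq hskew hsq hpp hpm
  have hΦm : Φ Em = 0 :=
    apply_eq_zero_of_skew_of_sq hskew (fun w => by rw [hsq, add_right_comm]) hmm hmp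
  have hGp : G Ep = Em := by
    have h := hGc Ep
    rw [hΦp, hpp, hmp] at h
    simpa [sub_eq_zero] using h.symm
  have hGm : G Em = Ep := by rw [← hGp, hGsq]
  intro w
  have hp : gpair Ep (G (Φ w)) = 0 := by
    rw [← hGsa, hGp, ← neg_eq_zero, ← hskew, hΦm, gpair_zero_left]
  have hm : gpair Em (G (Φ w)) = 0 := by
    rw [← hGsa, hGm, ← neg_eq_zero, ← hskew, hΦp, gpair_zero_left]
  have h := congrArg Φ (hGc w)
  rw [map_neg, hsq, hp, hm] at h
  simpa [hΦp, hΦm] using h
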